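/- arXiv:math/0310173 — 2 statements merged into one kernel-verified Lean document; each statement's English description precedes it below -/
import Mathlib

section
/- Let A be a commutative Poisson algebra over a field k of characteristic 0. Every minimal prime ideal p ⊆ A is a Poisson ideal, i.e., {p, a} ∈ p for every p ∈ p and a ∈ A. -/
/-- A Poisson bracket on a commutative `k`-algebra `A`: a `k`-bilinear,
skew-symmetric operation satisfying the Leibniz rule and the Jacobi identity. -/
def IsPoissonBracket (k : Type*) {A : Type*} [CommRing k] [CommRing A] [Algebra k A]
    (b : A → A → A) : Prop :=
  (∀ a : A, IsLinearMap k (b a)) ∧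
  (∀ a : A, IsLinearMap k (fun x => b x a)) ∧
  (∀ x y : A, b x y = - b y x) ∧
  (∀ a x y : A, b a (x * y) = b a x * y + b a y * x) ∧
  (∀ a x y : A, b a (b x y) + b x (b y a) + b y (b a x) = 0)

theorem Ideal.exists_mul_pow_eq_zero_of_mem_minimalPrimes {A : Type*} [CommRing A]
    {p : Ideal A} (hp : p ∈ minimalPrimes A) {x : A} (hx : x ∈ p) :
    ∃ s ∉ p, ∃ n : ℕ, s * x ^ n = 0 := by
  have : p.IsPrime := hp.isPrime
  have hmem : algebraMap A (Localization.AtPrime p) x ∈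
      ((⊥ : Ideal A).map (algebraMap A (Localization.AtPrime p))).radical := by
    rw [IsLocalization.AtPrime.radical_map_of_mem_minimalPrimes (Localization.AtPrime p) p ⊥ hp]
    exact Ideal.mem_map_of_mem _ hx
  obtain ⟨n, hn⟩ := hmem
  rw [Ideal.map_bot, Ideal.mem_bot, ← map_pow, IsLocalization.map_eq_zero_iff p.primeCompl] at hn
  obtain ⟨s, hs⟩ := hn
  exact ⟨s, s.2, n, hs⟩

theorem Derivation.apply_mem_of_mul_pow_mul_pow_eq_zero {k A : Type*} [Field k] [CharZero k]
    [CommRing A] [Algebra k A] (D : Derivation k A A) {p : Ideal A} (hp : p.IsPrime) {x : A}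
    (n : ℕ) : ∀ (e : ℕ) (s : A), s ∉ p → s * x ^ n * D x ^ e = 0 → D x ∈ p := by
  induction n with
  | zero =>
    intro e s hs h
    refine hp.mem_of_pow_mem e ((hp.mem_or_mem ?_).resolve_left hs)
    rw [pow_zero, mul_one] at h
    exact h ▸ p.zero_mem
  | succ n ih =>
    intro e s hs h
    have hunit : IsUnit ((n + 1 : ℕ) : A) := by
      rw [← _root_.map_natCast (algebraMap k A)]
      exact (IsUnit.mk0 _ (Nat.cast_ne_zero.mpr n.succ_ne_zero)).map _
    refine ih (e + 2) (((n + 1 : ℕ) : A) * (s * s)) ?_ ?_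
    · intro hmem
      have := (hp.mem_or_mem hmem).resolve_left
        fun hn => hp.ne_top (Ideal.eq_top_of_isUnit_mem _ hn hunit)
      exact (hp.mem_or_mem this).elim hs hs
    · have hD := congrArg D h
      cases e with
      | zero =>
        simp only [Derivation.leibniz, Derivation.leibniz_pow, map_zero, smul_eq_mul,
          nsmul_eq_mul, Nat.add_sub_cancel, pow_zero, mul_one] at hD h ⊢
        linear_combination s * D x * hD - D s * D x * h
      | succ e =>
        simp only [Derivation.leibniz, Derivation.leibniz_pow, map_zero, smul_eq_mul,
          nsmul_eq_mul, Nat.add_sub_cancel] at hD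
        linear_combination s * D x * hD - (D s * D x + s * (e + 1 : ℕ) * D (D x)) * h

theorem Derivation.apply_mem_of_mem_minimalPrimes {k A : Type*} [Field k] [CharZero k]
    [CommRing A] [Algebra k A] (D : Derivation k A A) {p : Ideal A} (hp : p ∈ minimalPrimes A)
    {x : A} (hx : x ∈ p) : D x ∈ p := by
  obtain ⟨s, hs, n, h⟩ := Ideal.exists_mul_pow_eq_zero_of_mem_minimalPrimes hp hx
  exact D.apply_mem_of_mul_pow_mul_pow_eq_zero hp.isPrime n 0 s hs (by simpa using h)

/-- Every minimal prime of a Poisson algebra over a field of characteristic zero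
is a Poisson ideal. -/
theorem minimalPrime_isPoissonIdeal {k A : Type*} [Field k] [CharZero k] [CommRing A]
    [Algebra k A] (b : A → A → A) (hb : IsPoissonBracket k b)
    (p : Ideal A) (hp : p ∈ minimalPrimes A) :
    ∀ x ∈ p, ∀ a : A, b x a ∈ p := by
  intro x hx a
  obtain ⟨hlin, -, hskew, hleib, -⟩ := hb
  rw [hskew x a]
  refine p.neg_mem ?_
  exact (Derivation.mk' (hlin a).mk' fun x y => by
    simp only [IsLinearMap.mk'_apply, smul_eq_mul, hleib]
    ring).apply_mem_of_mem_minimalPrimes hp hx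
end

section
/- Let A₀ be a Noetherian domain over a field k of characteristic 0 equipped with a Poisson bracket, and let A be the integral closure of A₀ in Frac(A₀). Then the unique extension of the Poisson bracket to Frac(A₀) restricts to a Poisson bracket on A; in particular {f,g} ∈ A for all f,g ∈ A. -/
theorem Valuation.card_le_length_quotient_add_one {S Γ : Type*} [CommRing S]
    [LinearOrderedCommGroupWithZero Γ] (v : Valuation S Γ) (hv : ∀ s, v s ≤ 1) (J : Ideal S)
    (F : Finset Γ) (hF : ∀ γ ∈ F, ∃ s, v s = γ) (hJ : ∀ γ ∈ F, ∀ s ∈ J, v s ≤ γ) :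
    (F.card : ℕ∞) ≤ Module.length S (S ⧸ J) + 1 := by
  obtain hc | ⟨m, hm⟩ : F.card = 0 ∨ ∃ m, F.card = m + 1 := by
    cases h : F.card <;> simp
  · simp [hc]
  let I : Γ → Ideal S := fun γ =>
    { carrier := {s | v s ≤ γ}
      add_mem' := fun {a b} ha hb => (v.map_add a b).trans (max_le ha hb)
      zero_mem' := by simp
      smul_mem' := fun c x hx => by
        simpa using mul_le_mul' (hv c) hx }
  let e := F.orderEmbOfFin hm
  have he : ∀ i, e i ∈ F := fun i => F.orderEmbOfFin_mem hm i
  let g : Fin (m + 1) → Submodule S (S ⧸ J) := fun i =>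
    Submodule.map J.mkQ (I (e i))
  have hcomap : ∀ i, Submodule.comap J.mkQ (g i) = I (e i) := fun i => by
    rw [show g i = Submodule.map J.mkQ (I (e i)) from rfl, Submodule.comap_map_mkQ, sup_eq_right]
    exact fun s hs => hJ _ (he i) s hs
  have hg : StrictMono g := by
    intro i j hij
    have hlt : e i < e j := e.strictMono hij
    refine lt_of_le_not_ge (Submodule.map_mono fun s hs => le_trans hs hlt.le) fun h => ?_
    have h' := Submodule.comap_mono (f := J.mkQ) h
    rw [hcomap, hcomap] at h'
    obtain ⟨s, hs⟩ := hF _ (he j)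
    have : v s ≤ e i := h' (show v s ≤ e j from hs.le)
    exact absurd (hs ▸ this) hlt.not_ge
  have key := Order.LTSeries.length_le_krullDim (LTSeries.mk m g hg)
  rw [← Module.coe_length] at key
  have : (m : ℕ∞) ≤ Module.length S (S ⧸ J) := by exact_mod_cast key
  rw [hm]
  push_cast
  gcongr

/-- In a Noetherian domain `S` with `S ⧸ (y)` Artinian, a valuation that is at most `1` on `S` and
smaller than `1` at `y` is archimedean with respect to `y`. -/
theorem Valuation.exists_pow_le_of_isArtinianRing_quotient {S Γ : Type*} [CommRing S] [IsDomain S]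
    [IsNoetherianRing S] [LinearOrderedCommGroupWithZero Γ] (v : Valuation S Γ)
    (hv : ∀ s, v s ≤ 1) {y : S} (hy : v y < 1) [IsArtinianRing (S ⧸ Ideal.span {y})]
    {b : S} (hb : b ≠ 0) : ∃ c : ℕ, v (y ^ c) ≤ v b := by
  by_contra! hcon
  let q : Ideal S :=
    { carrier := {s | v s < 1}
      add_mem' := fun {a b} ha hb => (v.map_add a b).trans_lt (max_lt ha hb)
      zero_mem' := by simp
      smul_mem' := fun c x hx => by
        have : v (c * x) ≤ 1 * v x := by rw [map_mul]; exact mul_le_mul' (hv c) le_rfl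
        exact (this.trans_eq (one_mul _)).trans_lt hx }
  have hq : q.IsPrime := by
    refine ⟨fun h => ?_, fun {a b} hab => ?_⟩
    · have : (1 : S) ∈ q := h ▸ Submodule.mem_top
      exact absurd (show v (1 : S) < 1 from this) (by simp)
    · by_contra! h
      have h1 : v a = 1 := le_antisymm (hv a) (not_lt.mp h.1)
      have h2 : v b = 1 := le_antisymm (hv b) (not_lt.mp h.2)
      have : v (a * b) < 1 := hab
      simp [h1, h2] at this
  let p : Ideal S :=
    { carrier := {s | ∀ c : ℕ, v s ≤ v (y ^ c)}
      add_mem' := fun {a b} ha hb c => (v.map_add a b).trans (max_le (ha c) (hb c))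
      zero_mem' := by simp
      smul_mem' := fun c x hx n => by
        have : v (c * x) ≤ 1 * v x := by rw [map_mul]; exact mul_le_mul' (hv c) le_rfl
        exact (this.trans_eq (one_mul _)).trans (hx n) }
  have hp : p.IsPrime := by
    refine ⟨fun h => ?_, fun {a b} hab => ?_⟩
    · have : (1 : S) ∈ p := h ▸ Submodule.mem_top
      have := this 1
      simp at this
      exact absurd hy this.not_gt
    · by_contra! h
      have h1 : ∃ c : ℕ, v (y ^ c) < v a := by
        by_contra! h'; exact h.1 h'
      have h2 : ∃ c : ℕ, v (y ^ c) < v b := by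
        by_contra! h'; exact h.2 h'
      obtain ⟨c, hc⟩ := h1
      obtain ⟨d, hd⟩ := h2
      have := hab (c + d)
      rw [pow_add, map_mul, map_mul] at this
      exact absurd this (mul_lt_mul'' hc hd zero_le zero_le).not_ge
  have hbp : b ∈ p := fun c => (hcon c).le
  have hyq : y ∈ q := hy
  have hyp : y ∉ p := fun h => by
    have h2 := h 2
    have h0 : v y ≠ 0 := fun h0 => by
      have := hcon 1
      simp [h0] at this
    rw [map_pow, pow_two] at h2
    have : v y * v y < v y * 1 := mul_lt_mul_of_pos_left hy (zero_lt_iff.mpr h0)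
    rw [mul_one] at this
    exact absurd h2 this.not_ge
  have hpq : p < q := by
    refine lt_of_le_of_ne (fun s hs => ?_) fun h => hyp (h ▸ hyq)
    have := hs 1
    rw [pow_one] at this
    exact lt_of_le_of_lt this hy
  have hmin : q ∈ (Ideal.span {y}).minimalPrimes := by
    refine ⟨⟨hq, by simpa [Ideal.span_le] using hyq⟩, fun r ⟨hr, hyr⟩ hrq => ?_⟩
    have hmap : (r.map (Ideal.Quotient.mk (Ideal.span {y}))).IsPrime :=
      Ideal.map_isPrime_of_surjective Ideal.Quotient.mk_surjective (by simpa using hyr)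
    have hmax := Ideal.comap_isMaximal_of_surjective (Ideal.Quotient.mk (Ideal.span {y}))
      Ideal.Quotient.mk_surjective (K := r.map (Ideal.Quotient.mk (Ideal.span {y})))
    rw [Ideal.comap_map_of_surjective _ Ideal.Quotient.mk_surjective,
      ← RingHom.ker_eq_comap_bot, Ideal.mk_ker, sup_eq_left.mpr hyr] at hmax
    exact (hmax.eq_of_le hq.ne_top hrq).ge
  have h1 := Ideal.height_le_one_of_isPrincipal_of_mem_minimalPrimes _ q hmin
  have hbot : (⊥ : Ideal S) < p := bot_lt_iff_ne_bot.mpr fun h => hb (by simpa [h] using hbp)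
  have h2 : p.height + 1 ≤ q.height := Ideal.height_add_one_le_of_lt_of_isPrime hpq
  have h3 : (⊥ : Ideal S).height + 1 ≤ p.height := Ideal.height_add_one_le_of_lt_of_isPrime hbot
  have h4 : (1 : ℕ∞) + 1 ≤ 1 :=
    (add_le_add_left ((le_add_left le_rfl).trans h3) 1).trans (h2.trans h1)
  exact absurd h4 (by decide)

/-- If `S` is a Noetherian domain and `S ⧸ (y)` is Artinian, then the valuations centered at a prime
containing `y` have value groups that are, up to a uniform exponent, generated by the value of
`y`. -/
theorem exists_forall_valuationSubring_valuation_pow_eq_zpow {S K : Type*} [CommRing S] [IsDomain S]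
    [IsNoetherianRing S] [Field K] [Algebra S K] [IsFractionRing S K] {y : S} (hy0 : y ≠ 0)
    [IsArtinianRing (S ⧸ Ideal.span {y})] :
    ∃ L : ℕ, 0 < L ∧ ∀ W : ValuationSubring K, (∀ s, algebraMap S K s ∈ W) →
      W.valuation (algebraMap S K y) < 1 → ∀ a : K, a ≠ 0 →
        ∃ k : ℤ, W.valuation (a ^ L) = W.valuation (algebraMap S K y) ^ k := by
  classical
  have hyR : y ∈ nonZeroDivisors S := mem_nonZeroDivisors_of_ne_zero hy0
  have : IsArtinian S (S ⧸ Ideal.span {y}) :=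
    isArtinian_of_surjective_algebraMap (Ideal.Quotient.mk_surjective (I := .span {y}))
  have hlen : Ring.ord S y ≠ ⊤ := Module.length_ne_top
  obtain ⟨n, hn⟩ := ENat.ne_top_iff_exists.mp hlen
  refine ⟨n.factorial, n.factorial_pos, fun W hW hyW a ha => ?_⟩
  set Y := algebraMap S K y with hY
  have hY0 : Y ≠ 0 := by simpa [hY] using hy0
  have hvY0 : W.valuation Y ≠ 0 := by simpa using hY0
  let v : Valuation S W.ValueGroup := W.valuation.comap (algebraMap S K)
  have hvs : ∀ s, v s = W.valuation (algebraMap S K s) := fun s => rfl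
  have hv : ∀ s, v s ≤ 1 := fun s => (W.valuation_le_one_iff _).mpr (hW s)
  suffices h : ∃ i j : ℕ, i < j ∧ j ≤ n ∧ ∃ k : ℤ,
      W.valuation a ^ j = W.valuation a ^ i * W.valuation Y ^ k by
    obtain ⟨i, j, hij, hjn, k, hk⟩ := h
    have hva : W.valuation a ≠ 0 := by simpa using ha
    have h1 : W.valuation a ^ (j - i) = W.valuation Y ^ k := by
      have : W.valuation a ^ j = W.valuation a ^ i * W.valuation a ^ (j - i) := by
        rw [← pow_add]; congr 1; lia
      rw [this] at hk
      exact mul_left_cancel₀ (pow_ne_zero _ hva) hk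
    obtain ⟨c, hc⟩ := Nat.dvd_factorial (by lia : 0 < j - i) (by lia : j - i ≤ n)
    refine ⟨k * c, ?_⟩
    rw [hc, map_pow, pow_mul, h1, zpow_mul, zpow_natCast]
  by_contra! hcon
  obtain ⟨d, hd⟩ := IsLocalization.exist_integer_multiples_of_finset (nonZeroDivisors S)
    ((Finset.range (n + 1)).image fun i => a ^ i)
  have hd' : ∀ j : ℕ, ∃ s : S, j ≤ n → algebraMap S K s = algebraMap S K d * a ^ j := by
    intro j
    by_cases hj : j ≤ n
    · obtain ⟨s, hs⟩ := hd (a ^ j) (Finset.mem_image_of_mem _ (by simpa using Nat.lt_succ_of_le hj))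
      exact ⟨s, fun _ => by rw [hs, Algebra.smul_def]⟩
    · exact ⟨0, fun h => absurd h hj⟩
  choose w hw using hd'
  have hd0 : algebraMap S K d ≠ 0 := by simp
  have hw0 : ∀ j ≤ n, w j ≠ 0 := fun j hj h => by
    have := hw j hj
    rw [h, map_zero] at this
    exact mul_ne_zero hd0 (pow_ne_zero _ ha) this.symm
  have harch : ∀ j : ℕ, ∃ c : ℕ, j ≤ n → v (y ^ c) ≤ v (w j) := by
    intro j
    by_cases hj : j ≤ n
    · obtain ⟨c, hc⟩ := v.exists_pow_le_of_isArtinianRing_quotient hv hyW (hw0 j hj)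
      exact ⟨c, fun _ => hc⟩
    · exact ⟨0, fun h => absurd h hj⟩
  choose c' hc' using harch
  let c := (Finset.range (n + 1)).sup c'
  have hc : ∀ j ≤ n, v (y ^ c) ≤ v (w j) := fun j hj => by
    refine le_trans ?_ (hc' j hj)
    rw [map_pow, map_pow]
    exact pow_le_pow_right_of_le_one' (hv y)
      (Finset.le_sup (f := c') (by simpa using Nat.lt_succ_of_le hj))
  let k := c * n + 2
  let f : ℕ × ℕ → W.ValueGroup := fun p => v (w p.1 * y ^ p.2)
  have hfv : ∀ p : ℕ × ℕ, p.1 ≤ n → f p = W.valuation (algebraMap S K d) *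
      (W.valuation a ^ p.1 * W.valuation Y ^ p.2) := fun p hp => by
    simp only [f, hvs, map_mul, hw _ hp, map_pow, mul_assoc, ← hY]
  have hvd : W.valuation (algebraMap S K d) ≠ 0 := by simp
  have aux : ∀ p q : ℕ × ℕ, p.1 < q.1 → q.1 ≤ n → f p ≠ f q := by
    intro p q hpq hq h
    rw [hfv p (by lia), hfv q hq] at h
    have h := mul_left_cancel₀ hvd h
    refine hcon p.1 q.1 hpq hq ((p.2 : ℤ) - q.2) ?_
    rw [zpow_sub₀ hvY0, zpow_natCast, zpow_natCast]
    field_simp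
    exact h.symm
  have hinj : Set.InjOn f (Finset.range (n + 1) ×ˢ Finset.range k : Finset (ℕ × ℕ)) := by
    intro p hp q hq h
    simp only [Finset.coe_product, Finset.coe_range, Set.mem_prod, Set.mem_Iio] at hp hq
    rcases lt_trichotomy p.1 q.1 with h1 | h1 | h1
    · exact absurd h (aux p q h1 (by lia))
    · rw [hfv p (by lia), hfv q (by lia), h1] at h
      have hva : W.valuation a ≠ 0 := by simpa using ha
      have h := mul_left_cancel₀ (pow_ne_zero _ hva) (mul_left_cancel₀ hvd h)
      refine Prod.ext h1 ?_
      exact (pow_right_injective₀ (zero_lt_iff.mpr hvY0) hyW.ne) h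
    · exact absurd h.symm (aux q p h1 (by lia))
  have hcard := v.card_le_length_quotient_add_one hv (Ideal.span {y ^ (c + k)})
    ((Finset.range (n + 1) ×ˢ Finset.range k).image f)
    (fun γ hγ => by
      obtain ⟨p, -, rfl⟩ := Finset.mem_image.mp hγ
      exact ⟨_, rfl⟩)
    (fun γ hγ s hs => by
      obtain ⟨p, hp, rfl⟩ := Finset.mem_image.mp hγ
      simp only [Finset.mem_product, Finset.mem_range] at hp
      obtain ⟨t, rfl⟩ := Ideal.mem_span_singleton.mp hs
      have h1 : v (y ^ (c + k) * t) ≤ v (y ^ (c + k)) := by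
        rw [map_mul]; exact mul_le_of_le_one_right' (hv t)
      refine h1.trans ?_
      rw [pow_add, map_mul]
      simp only [f, map_mul]
      refine mul_le_mul' (hc _ (by lia)) ?_
      rw [map_pow, map_pow]
      exact pow_le_pow_right_of_le_one' (hv y) (by lia))
  rw [Finset.card_image_of_injOn hinj, Finset.card_product, Finset.card_range, Finset.card_range,
    show Module.length S (S ⧸ Ideal.span {y ^ (c + k)}) = Ring.ord S (y ^ (c + k)) from rfl,
    Ring.ord_pow hyR, ← hn] at hcard
  have hcard' : (n + 1) * k ≤ (c + k) * n + 1 := by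
    rw [nsmul_eq_mul] at hcard
    exact_mod_cast hcard
  simp only [k] at hcard'
  nlinarith

theorem ValuationSubring.mem_of_isIntegral {R K : Type*} [CommRing R] [Field K] [Algebra R K]
    (W : ValuationSubring K) (hW : ∀ r : R, algebraMap R K r ∈ W) {x : K} (hx : IsIntegral R x) :
    x ∈ W := by
  obtain ⟨p, hp, h0⟩ := hx
  let f : R →+* W := (algebraMap R K).codRestrict W hW
  have : IsIntegral W x := by
    refine ⟨p.map f, hp.map f, ?_⟩
    rw [Polynomial.eval₂_map]
    exact h0
  obtain ⟨w, rfl⟩ := IsIntegrallyClosed.isIntegral_iff.mp this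
  exact w.2

theorem exists_valuationSubring_notMem_of_not_isIntegral {R K : Type*} [CommRing R] [Field K]
    [Algebra R K] {h : K} (hh : ¬ IsIntegral R h) :
    ∃ W : ValuationSubring K, (∀ r : R, algebraMap R K r ∈ W) ∧ h ∉ W := by
  obtain ⟨W, h1, h2⟩ := Subring.exists_le_valuationSubring_of_isIntegrallyClosedIn
    (R := (integralClosure R K).toSubring) (x := h) hh
  exact ⟨W, fun r => h1 (isIntegral_algebraMap : IsIntegral R (algebraMap R K r)), h2⟩

theorem exists_valuationSubring_notMem_of_forall_mul_ne {R K : Type*} [CommRing R] [Field K]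
    [Algebra R K] (V : ValuationSubring K) (hV : ∀ r : R, algebraMap R K r ∈ V) {u : K}
    (hu : ∀ a s : K, IsIntegral R a → IsIntegral R s → V.valuation s = 1 → u * s ≠ a) :
    ∃ W : ValuationSubring K, u ∉ W ∧
      ∀ r : K, IsIntegral R r → r ∈ W ∧ (W.valuation r < 1 ↔ V.valuation r < 1) := by
  let A : Subring K := (integralClosure R K).toSubring
  have hA : A ≤ V.toSubring := fun x hx => V.mem_of_isIntegral hV hx
  let P : Ideal A := (IsLocalRing.maximalIdeal V).comap (Subring.inclusion hA)
  have hP : ∀ x : A, x ∈ P ↔ V.valuation (x : K) < 1 := fun x =>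
    V.valuation_lt_one_iff (Subring.inclusion hA x)
  have hPc : ∀ x : A, x ∉ P ↔ V.valuation (x : K) = 1 := fun x => by
    rw [hP, not_lt]
    exact ⟨fun h => le_antisymm ((V.valuation_le_one_iff _).mpr (hA x.2)) h, fun h => h.ge⟩
  have : P.IsPrime := inferInstanceAs ((IsLocalRing.maximalIdeal V).comap _).IsPrime
  let O := LocalSubring.ofPrime A P
  have hunit : ∀ m : A, m ∉ P → ∃ t ∈ O.toSubring, (m : K) * t = 1 := fun m hm => by
    obtain ⟨t, ht⟩ :=
      (IsLocalization.map_units O.toSubring (⟨m, hm⟩ : P.primeCompl)).exists_right_inv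
    exact ⟨t, t.2, congrArg Subtype.val ht⟩
  have hO : IsIntegrallyClosedIn O.toSubring K := by
    rw [Subring.isIntegrallyClosedIn_iff]
    intro x hx
    obtain ⟨m, hm⟩ := IsIntegral.exists_multiple_integral_of_isLocalization P.primeCompl x hx
    obtain ⟨a, ha⟩ := IsIntegrallyClosedIn.isIntegral_iff.mp hm
    obtain ⟨t, ht, hmt⟩ := hunit m m.2
    have hmx : (a : K) = (m : A) * x := ha
    have : x = a * t := by rw [hmx]; linear_combination (-x) * hmt
    rw [this]
    exact mul_mem (LocalSubring.le_ofPrime A P a.2) ht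
  have huO : u ∉ O.toSubring := fun h => by
    obtain ⟨⟨a, s⟩, has⟩ := IsLocalization.surj P.primeCompl (⟨u, h⟩ : O.toSubring)
    exact hu a (s : A) a.2 (s : A).2 ((hPc _).mp s.2) (congrArg Subtype.val has)
  obtain ⟨W, ⟨h1, h2⟩, h3⟩ := LocalSubring.exists_le_valuationSubring_of_isIntegrallyClosedIn huO
  have hAW : ∀ r ∈ A, r ∈ W := fun r hr => h1 (LocalSubring.le_ofPrime A P hr)
  refine ⟨W, h3, fun r hr => ⟨hAW r hr, ?_⟩⟩
  let rO : O.toSubring := ⟨r, LocalSubring.le_ofPrime A P hr⟩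
  have e1 : rO ∈ IsLocalRing.maximalIdeal O.toSubring ↔ (⟨r, hr⟩ : A) ∈ P :=
    IsLocalization.AtPrime.to_map_mem_maximal_iff O.toSubring P (⟨r, hr⟩ : A)
  rw [← hP ⟨r, hr⟩, ← e1, ← W.valuation_lt_one_iff ⟨r, hAW r hr⟩]
  have := ((IsLocalRing.local_hom_TFAE (Subring.inclusion h1)).out 0 4).mp h2
  rw [← this]
  rfl

open IsLocalRing in
theorem IsLocalRing.exists_forall_valuationSubring_valuation_pow_eq_zpow {R K : Type*} [CommRing R]
    [IsDomain R] [IsNoetherianRing R] [IsLocalRing R] [Field K] [Algebra R K] [IsFractionRing R K]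
    {h : K} (h0 : h ≠ 0)
    (hm : ∀ x ∈ maximalIdeal R, IsIntegral R (algebraMap R K x * h)) :
    ∃ L : ℕ, 0 < L ∧ ∀ W : ValuationSubring K, (∀ r : R, algebraMap R K r ∈ W) → h ∉ W →
      ∀ a : K, a ≠ 0 → ∃ k : ℤ, W.valuation (a ^ L) = W.valuation h⁻¹ ^ k := by
  classical
  obtain ⟨G, hG⟩ := (IsNoetherian.noetherian (maximalIdeal R))
  let T : Finset K := insert h⁻¹ (G.image fun x => algebraMap R K x * h)
  let S : Subalgebra R K := Algebra.adjoin R (T : Set K)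
  have : Algebra.FiniteType R S :=
    (Subalgebra.fg_iff_finiteType S).mp (Subalgebra.fg_adjoin_finset T)
  have : IsNoetherianRing S := Algebra.FiniteType.isNoetherianRing R S
  have : IsFractionRing S K := by
    refine IsFractionRing.of_field S K fun z => ?_
    obtain ⟨a, b, -, rfl⟩ := IsFractionRing.div_surjective (A := R) z
    exact ⟨algebraMap R S a, algebraMap R S b, rfl⟩
  have hTS : ∀ t ∈ T, t ∈ S := fun t ht => Algebra.subset_adjoin ht
  let y : S := ⟨h⁻¹, hTS _ (Finset.mem_insert_self _ _)⟩
  have hy0 : y ≠ 0 := fun e => inv_ne_zero h0 (congrArg Subtype.val e)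
  have hGT : ∀ x ∈ G, algebraMap R K x * h ∈ S := fun x hx =>
    hTS _ (Finset.mem_insert_of_mem (Finset.mem_image_of_mem _ hx))
  let I : Ideal S := Ideal.span {y}
  have hmI : ∀ x ∈ maximalIdeal R, algebraMap R S x ∈ I := by
    have : maximalIdeal R ≤ I.comap (algebraMap R S) := by
      rw [← hG, Ideal.span_le]
      intro x hx
      refine Ideal.mem_span_singleton.mpr ⟨⟨_, hGT x hx⟩, Subtype.ext ?_⟩
      change algebraMap R K x = h⁻¹ * (algebraMap R K x * h)
      field_simp
    exact this
  have hint : Algebra.IsIntegral R (S ⧸ I) := by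
    have key : ∀ z (hz : z ∈ S), IsIntegral R (Ideal.Quotient.mkₐ R I ⟨z, hz⟩) := by
      intro z hz
      induction hz using Algebra.adjoin_induction with
      | mem t ht =>
        rcases Finset.mem_insert.mp (Finset.mem_coe.mp ht) with rfl | ht
        · have : Ideal.Quotient.mkₐ R I y = 0 :=
            Ideal.Quotient.eq_zero_iff_mem.mpr (Ideal.mem_span_singleton_self y)
          change IsIntegral R (Ideal.Quotient.mkₐ R I y)
          rw [this]
          exact isIntegral_zero
        · obtain ⟨x, hx, rfl⟩ := Finset.mem_image.mp ht
          have hxm : x ∈ maximalIdeal R := hG ▸ Ideal.subset_span hx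
          have : IsIntegral R (⟨_, hGT x hx⟩ : S) :=
            (isIntegral_algHom_iff S.val Subtype.val_injective).mp (hm x hxm)
          exact this.map (Ideal.Quotient.mkₐ R I)
      | algebraMap r => exact (isIntegral_algebraMap (A := S ⧸ I))
      | add a b ha hb h1 h2 => exact h1.add h2
      | mul a b ha hb h1 h2 => exact h1.mul h2
    refine ⟨fun q => ?_⟩
    obtain ⟨⟨z, hz⟩, rfl⟩ := Ideal.Quotient.mkₐ_surjective R I q
    exact key z hz
  have : IsArtinianRing (S ⧸ I) := by
    rw [isArtinianRing_iff_krullDimLE_zero, Ring.krullDimLE_zero_iff]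
    intro Q hQ
    refine Ideal.isMaximal_of_isIntegral_of_isMaximal_comap (R := R) Q ?_
    have hle : maximalIdeal R ≤ Q.comap (algebraMap R (S ⧸ I)) := fun x hx => by
      have : algebraMap R (S ⧸ I) x = 0 := Ideal.Quotient.eq_zero_iff_mem.mpr (hmI x hx)
      rw [Ideal.mem_comap, this]
      exact Q.zero_mem
    have hne : Q.comap (algebraMap R (S ⧸ I)) ≠ ⊤ := (Ideal.IsPrime.comap _).ne_top
    rw [← (maximalIdeal.isMaximal R).eq_of_le hne hle]
    exact maximalIdeal.isMaximal R
  obtain ⟨L, hL, H⟩ := _root_.exists_forall_valuationSubring_valuation_pow_eq_zpow (K := K) hy0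
  refine ⟨L, hL, fun W hW hhW => H W (fun s => ?_) ?_⟩
  · have hyW : h⁻¹ ∈ W := (W.mem_or_inv_mem h).resolve_left hhW
    obtain ⟨z, hz⟩ := s
    change z ∈ W
    induction hz using Algebra.adjoin_induction with
    | mem t ht =>
      rcases Finset.mem_insert.mp (Finset.mem_coe.mp ht) with rfl | ht
      · exact hyW
      · obtain ⟨x, hx, rfl⟩ := Finset.mem_image.mp ht
        exact W.mem_of_isIntegral hW (hm x (hG ▸ Ideal.subset_span hx))
    | algebraMap r => exact hW r
    | add a b ha hb h1 h2 => exact add_mem h1 h2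
    | mul a b ha hb h1 h2 => exact mul_mem h1 h2
  · change W.valuation h⁻¹ < 1
    rw [map_inv₀]
    exact inv_lt_one_of_one_lt₀ (not_le.mp fun h' => hhW ((W.valuation_le_one_iff h).mp h'))

open IsLocalRing in
/-- A local form of the Mori–Nagata theorem: if `h` is not integral over the Noetherian local domain
`R` but is multiplied into the integral closure by the maximal ideal, then `h` is excluded by a
valuation subring that is a localization of the integral closure and has discrete values. -/
theorem IsLocalRing.exists_valuationSubring_notMem {R K : Type*} [CommRing R]
    [IsDomain R] [IsNoetherianRing R] [IsLocalRing R] [Field K] [Algebra R K] [IsFractionRing R K]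
    {h : K} (hh : ¬ IsIntegral R h)
    (hm : ∀ x ∈ maximalIdeal R, IsIntegral R (algebraMap R K x * h)) :
    ∃ W : ValuationSubring K, (∀ r : R, algebraMap R K r ∈ W) ∧ h ∉ W ∧
      (∀ u ∈ W, ∃ a s : K, IsIntegral R a ∧ IsIntegral R s ∧ W.valuation s = 1 ∧ u * s = a) ∧
      ∃ L : ℕ, 0 < L ∧ ∀ a : K, a ≠ 0 → ∃ k : ℤ, W.valuation (a ^ L) = W.valuation h⁻¹ ^ k := by
  have h0 : h ≠ 0 := by rintro rfl; exact hh isIntegral_zero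
  obtain ⟨L, hL, hexp⟩ := IsLocalRing.exists_forall_valuationSubring_valuation_pow_eq_zpow h0 hm
  have hy0 : ∀ W : ValuationSubring K, 0 < W.valuation h⁻¹ := fun W =>
    zero_lt_iff.mpr (by simpa using h0)
  have hy1 : ∀ W : ValuationSubring K, h ∉ W → W.valuation h⁻¹ < 1 := fun W hW => by
    rw [map_inv₀]
    exact inv_lt_one_of_one_lt₀ (not_le.mp fun h' => hW ((W.valuation_le_one_iff h).mp h'))
  have hyh : ∀ (W : ValuationSubring K) (n : ℕ),
      W.valuation h⁻¹ ^ n * W.valuation h ^ n = 1 := fun W n => by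
    rw [← mul_pow, ← map_mul, inv_mul_cancel₀ h0, map_one, one_pow]
  have hint1 : ∀ W : ValuationSubring K, (∀ r : R, algebraMap R K r ∈ W) →
      ∀ x, IsIntegral R x → W.valuation x ≤ 1 := fun W hW x hx =>
    (W.valuation_le_one_iff x).mpr (W.mem_of_isIntegral hW hx)
  have hnat : ∀ W : ValuationSubring K, (∀ r : R, algebraMap R K r ∈ W) → h ∉ W →
      ∀ a : K, a ≠ 0 → IsIntegral R a →
        ∃ n : ℕ, W.valuation a ^ L = W.valuation h⁻¹ ^ n := by
    intro W hW hhW a ha hai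
    obtain ⟨k, hk⟩ := hexp W hW hhW a ha
    rw [map_pow] at hk
    have hk0 : 0 ≤ k := by
      have h1 : W.valuation h⁻¹ ^ k ≤ W.valuation h⁻¹ ^ (0 : ℤ) := by
        rw [zpow_zero, ← hk]
        exact pow_le_one₀ zero_le (hint1 W hW a hai)
      exact (zpow_le_zpow_iff_right_of_lt_one₀ (hy0 W) (hy1 W hhW)).mp h1
    lift k to ℕ using hk0
    exact ⟨k, by rw [hk, zpow_natCast]⟩
  have hsub : ∀ (W : ValuationSubring K) (n m : ℕ), h ∉ W → m ≤ n →
      W.valuation h⁻¹ ^ n * W.valuation h ^ m ≤ 1 := by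
    intro W n m hW hmn
    rw [← hyh W m]
    exact mul_le_mul' (pow_le_pow_right_of_le_one' (hy1 W hW).le hmn) le_rfl
  obtain ⟨x, hx0, hxm⟩ : ∃ x : R, x ≠ 0 ∧ x ∈ maximalIdeal R := by
    obtain ⟨a, x, hx, e⟩ := IsFractionRing.div_surjective (A := R) h
    refine ⟨x, nonZeroDivisors.ne_zero hx, fun hu => hh ?_⟩
    obtain ⟨x', hx'⟩ := hu.exists_right_inv
    have h1 : algebraMap R K x * algebraMap R K x' = 1 := by rw [← map_mul, hx', map_one]
    have : h = algebraMap R K (a * x') := by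
      rw [← e, map_mul, eq_comm, eq_div_iff (left_ne_zero_of_mul_eq_one h1)]
      linear_combination algebraMap R K a * h1
    rw [this]
    exact isIntegral_algebraMap
  set X := algebraMap R K x with hX
  have hX0 : X ≠ 0 := by simpa [hX] using hx0
  have hXi : IsIntegral R X := isIntegral_algebraMap
  have hXlt : ∀ W : ValuationSubring K, (∀ r : R, algebraMap R K r ∈ W) → h ∉ W →
      W.valuation X < 1 := by
    intro W hW hhW
    have h1 := hint1 W hW _ (hm x hxm)
    have h2 : X = (X * h) * h⁻¹ := by field_simp
    rw [h2, map_mul]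
    exact (mul_le_of_le_one_left' h1).trans_lt (hy1 W hhW)
  have hex : ∃ n : ℕ, ∃ W : ValuationSubring K, (∀ r : R, algebraMap R K r ∈ W) ∧ h ∉ W ∧
      W.valuation X ^ L = W.valuation h⁻¹ ^ n := by
    obtain ⟨W, hW, hhW⟩ := exists_valuationSubring_notMem_of_not_isIntegral hh
    obtain ⟨n, hn⟩ := hnat W hW hhW X hX0 hXi
    exact ⟨n, W, hW, hhW, hn⟩
  classical
  obtain ⟨n₀, ⟨V, hV, hhV, hVn⟩, hmin⟩ : ∃ n₀ : ℕ, (∃ W : ValuationSubring K,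
      (∀ r : R, algebraMap R K r ∈ W) ∧ h ∉ W ∧ W.valuation X ^ L = W.valuation h⁻¹ ^ n₀) ∧
      ∀ m < n₀, ¬ ∃ W : ValuationSubring K, (∀ r : R, algebraMap R K r ∈ W) ∧ h ∉ W ∧
        W.valuation X ^ L = W.valuation h⁻¹ ^ m :=
    ⟨Nat.find hex, Nat.find_spec hex, fun m => Nat.find_min hex⟩
  have hz : ∀ W : ValuationSubring K,
      W.valuation (X ^ L * h ^ n₀) = W.valuation X ^ L * W.valuation h ^ n₀ := fun W => by simp
  have hzi : IsIntegral R (X ^ L * h ^ n₀) := by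
    by_contra hzi
    obtain ⟨W, hW, hzW⟩ := exists_valuationSubring_notMem_of_not_isIntegral hzi
    have hhW : h ∉ W := fun hhW => hzW (mul_mem (pow_mem (hW x) L) (pow_mem hhW n₀))
    obtain ⟨n, hn⟩ := hnat W hW hhW X hX0 hXi
    refine hzW ((W.valuation_le_one_iff _).mp ?_)
    rw [hz, hn]
    exact hsub W n n₀ hhW (not_lt.mp fun hlt => hmin n hlt ⟨W, hW, hhW, hn⟩)
  have hzV : ¬ V.valuation (X ^ L * h ^ n₀) < 1 := by rw [hz, hVn, hyh]; exact lt_irrefl _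
  let D : ValuationSubring K → Prop := fun W =>
    ∀ r : K, IsIntegral R r → r ∈ W ∧ (W.valuation r < 1 ↔ V.valuation r < 1)
  have hDR : ∀ W, D W → ∀ r : R, algebraMap R K r ∈ W := fun W hW r =>
    (hW _ isIntegral_algebraMap).1
  have hDh : ∀ W, D W → h ∉ W := fun W hW hhW => hzV <| ((hW _ hzi).2).mp <| by
    rw [hz]
    have h1 : W.valuation X < 1 := ((hW X hXi).2).mpr (hXlt V hV hhV)
    have h2 : W.valuation h ^ n₀ ≤ 1 :=
      pow_le_one₀ zero_le ((W.valuation_le_one_iff h).mpr hhW)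
    exact (mul_le_of_le_one_right' h2).trans_lt (pow_lt_one₀ zero_le h1 hL.ne')
  have hD1 : ∀ W, D W → ∀ r, IsIntegral R r → (W.valuation r = 1 ↔ V.valuation r = 1) := by
    intro W hW r hr
    have h1 := hint1 W (hDR W hW) r hr
    have h2 := hint1 V hV r hr
    have h3 := (hW r hr).2
    rw [h1.lt_iff_ne, h2.lt_iff_ne] at h3
    exact not_iff_not.mp h3
  have hDV : D V := fun r hr => ⟨V.mem_of_isIntegral hV hr, Iff.rfl⟩
  have hfrac : ∀ u : K, (∀ W, D W → u ∈ W) →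
      ∃ a s : K, IsIntegral R a ∧ IsIntegral R s ∧ V.valuation s = 1 ∧ u * s = a := by
    intro u hu
    by_contra! hcon
    obtain ⟨W, huW, hW⟩ := exists_valuationSubring_notMem_of_forall_mul_ne V hV hcon
    exact huW (hu W hW)
  have hconst : ∀ a : K, a ≠ 0 → IsIntegral R a →
      ∃ n : ℕ, ∀ W, D W → W.valuation a ^ L = W.valuation h⁻¹ ^ n := by
    intro a ha hai
    have hex : ∃ n : ℕ, ∃ W, D W ∧ W.valuation a ^ L = W.valuation h⁻¹ ^ n := by
      obtain ⟨n, hn⟩ := hnat V hV hhV a ha hai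
      exact ⟨n, V, hDV, hn⟩
    obtain ⟨n, ⟨W₁, hW₁, hn⟩, hmin⟩ : ∃ n : ℕ,
        (∃ W, D W ∧ W.valuation a ^ L = W.valuation h⁻¹ ^ n) ∧
        ∀ m < n, ¬ ∃ W, D W ∧ W.valuation a ^ L = W.valuation h⁻¹ ^ m :=
      ⟨Nat.find hex, Nat.find_spec hex, fun m => Nat.find_min hex⟩
    have hz : ∀ W : ValuationSubring K,
      W.valuation (a ^ L * h ^ n) = W.valuation a ^ L * W.valuation h ^ n := fun W => by simp
    obtain ⟨α, s, hα, hs, hs1, e⟩ := hfrac (a ^ L * h ^ n) fun W hW => by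
      obtain ⟨m, hm⟩ := hnat W (hDR W hW) (hDh W hW) a ha hai
      refine (W.valuation_le_one_iff _).mp ?_
      rw [hz, hm]
      exact hsub W m n (hDh W hW) (not_lt.mp fun hlt => hmin m hlt ⟨W, hW, hm⟩)
    have he : ∀ W, D W → W.valuation (a ^ L * h ^ n) = W.valuation α := fun W hW => by
      rw [← e, W.valuation.map_mul _ s, (hD1 W hW s hs).mpr hs1, mul_one]
    have hα1 : V.valuation α = 1 := by
      rw [← hD1 W₁ hW₁ α hα, ← he W₁ hW₁, hz, hn, hyh]
    refine ⟨n, fun W hW => ?_⟩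
    have h1 := he W hW
    rw [(hD1 W hW α hα).mpr hα1, hz, ← hyh W n] at h1
    exact mul_right_cancel₀ (pow_ne_zero _ (by simpa using h0)) h1
  refine ⟨V, hV, hhV, fun u hu => ?_, L, hL, hexp V hV hhV⟩
  refine hfrac u fun W hW => ?_
  obtain rfl | hu0 := eq_or_ne u 0
  · exact zero_mem W
  obtain ⟨a, b, hb, rfl⟩ := IsFractionRing.div_surjective (A := R) u
  have ha0 : algebraMap R K a ≠ 0 := fun h => hu0 (by rw [h, zero_div])
  have hb0 : algebraMap R K b ≠ 0 := fun h => hu0 (by rw [h, div_zero])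
  obtain ⟨n, hn⟩ := hconst _ ha0 isIntegral_algebraMap
  obtain ⟨m, hm⟩ := hconst _ hb0 isIntegral_algebraMap
  have hle : ∀ W : ValuationSubring K, D W →
      (algebraMap R K a / algebraMap R K b ∈ W ↔ m ≤ n) := by
    intro W hW
    have hbW : 0 < W.valuation (algebraMap R K b) := zero_lt_iff.mpr (by simpa using hb0)
    rw [← W.valuation_le_one_iff, map_div₀, div_le_one₀ hbW,
      ← pow_le_pow_iff_left₀ zero_le zero_le hL.ne', hn W hW, hm W hW,
      pow_le_pow_iff_right_of_lt_one₀ (hy0 W) (hy1 W (hDh W hW))]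
  exact (hle W hW).mpr ((hle V hDV).mp hu)

theorem ValuationSubring.exists_uniformizer {K : Type*} [Field K] (W : ValuationSubring K) {y : K}
    (hy : W.valuation y < 1) (hy0 : y ≠ 0) {L : ℕ} (hL : 0 < L)
    (H : ∀ a : K, a ≠ 0 → ∃ k : ℤ, W.valuation (a ^ L) = W.valuation y ^ k) :
    ∃ π : K, π ≠ 0 ∧ W.valuation π < 1 ∧ (∀ a, W.valuation a < 1 → W.valuation a ≤ W.valuation π) ∧
      ∀ a ≠ 0, ∃ N : ℕ, W.valuation (π ^ N) ≤ W.valuation a := by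
  classical
  have hy0' : 0 < W.valuation y := zero_lt_iff.mpr (by simpa using hy0)
  have hex : ∃ n : ℕ, 0 < n ∧ ∃ π : K, W.valuation (π ^ L) = W.valuation y ^ n :=
    ⟨L, hL, y, map_pow _ _ _⟩
  obtain ⟨n, ⟨hn, π, hπ⟩, hmin⟩ : ∃ n : ℕ,
      (0 < n ∧ ∃ π : K, W.valuation (π ^ L) = W.valuation y ^ n) ∧
      ∀ m < n, ¬ (0 < m ∧ ∃ π : K, W.valuation (π ^ L) = W.valuation y ^ m) :=
    ⟨Nat.find hex, Nat.find_spec hex, fun m => Nat.find_min hex⟩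
  rw [map_pow] at hπ
  have hπ1 : W.valuation π < 1 := by
    rw [← pow_lt_one_iff_of_nonneg zero_le hL.ne', hπ]
    exact pow_lt_one₀ zero_le hy hn.ne'
  have hπ0 : π ≠ 0 := by
    rintro rfl
    rw [map_zero, zero_pow hL.ne'] at hπ
    exact (pow_ne_zero n hy0'.ne') hπ.symm
  refine ⟨π, hπ0, hπ1, fun a ha => ?_, fun a ha => ?_⟩
  · obtain rfl | ha0 := eq_or_ne a 0
    · rw [map_zero]; exact zero_le
    obtain ⟨k, hk⟩ := H a ha0
    have hk0 : 0 < k := by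
      rw [← zpow_lt_zpow_iff_right_of_lt_one₀ hy0' hy, ← hk, zpow_zero, map_pow]
      exact pow_lt_one₀ zero_le ha hL.ne'
    lift k to ℕ using hk0.le
    rw [zpow_natCast] at hk
    have hnk : n ≤ k := not_lt.mp fun hlt => hmin k hlt ⟨by exact_mod_cast hk0, a, hk⟩
    rw [← pow_le_pow_iff_left₀ zero_le zero_le hL.ne', hπ, ← map_pow, hk]
    exact pow_le_pow_right_of_le_one' hy.le hnk
  · obtain ⟨k, hk⟩ := H a ha
    refine ⟨k.toNat, ?_⟩
    rw [← pow_le_pow_iff_left₀ zero_le zero_le hL.ne', ← map_pow _ a, hk, map_pow, ← pow_mul,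
      mul_comm, pow_mul, hπ, ← pow_mul, ← zpow_natCast,
      zpow_le_zpow_iff_right_of_lt_one₀ hy0' hy]
    push_cast
    have h1 := Int.self_le_toNat k
    have h2 : (1 : ℤ) ≤ n := by exact_mod_cast hn
    nlinarith [Int.natCast_nonneg k.toNat]

/-- A form of the Mori–Nagata theorem: an element of the fraction field that is not integral over
the Noetherian domain `A` is excluded by a discrete valuation subring that is a localization of the
integral closure of `A`. -/
theorem exists_valuationSubring_uniformizer_of_not_isIntegral {A K : Type*} [CommRing A]
    [IsDomain A] [IsNoetherianRing A] [Field K] [Algebra A K] [IsFractionRing A K] {h : K}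
    (hh : ¬ IsIntegral A h) :
    ∃ W : ValuationSubring K, (∀ r : A, algebraMap A K r ∈ W) ∧ h ∉ W ∧
      (∀ u ∈ W, ∃ a s : K, IsIntegral A a ∧ IsIntegral A s ∧ W.valuation s = 1 ∧ u * s = a) ∧
      ∃ π : K, π ≠ 0 ∧ W.valuation π < 1 ∧
        (∀ a, W.valuation a < 1 → W.valuation a ≤ W.valuation π) ∧
        ∀ a ≠ 0, ∃ N : ℕ, W.valuation (π ^ N) ≤ W.valuation a := by
  let I : A → Ideal A := fun t =>
    { carrier := {s | IsIntegral A (algebraMap A K s * (algebraMap A K t * h))}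
      add_mem' := fun {a b} ha hb => by
        simp only [Set.mem_ofPred_eq, map_add, add_mul] at *
        exact ha.add hb
      zero_mem' := by simpa using isIntegral_zero
      smul_mem' := fun c x hx => by
        simp only [Set.mem_ofPred_eq, smul_eq_mul, map_mul, mul_assoc] at *
        exact isIntegral_algebraMap.mul hx }
  have hI : ∀ t s, s ∈ I t ↔ IsIntegral A (algebraMap A K s * (algebraMap A K t * h)) :=
    fun _ _ => Iff.rfl
  obtain ⟨_, ⟨t, ht, rfl⟩, hmax⟩ := set_has_maximal_iff_noetherian.mpr ‹IsNoetherianRing A›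
    (I '' {t | ¬ IsIntegral A (algebraMap A K t * h)}) ⟨_, 1, by simpa using hh, rfl⟩
  have hp : (I t).IsPrime := by
    refine ⟨fun e => ht ?_, fun {a b} hab => or_iff_not_imp_right.mpr fun hb => ?_⟩
    · have : (1 : A) ∈ I t := e ▸ Submodule.mem_top
      simpa [hI] using this
    · have hb' : ¬ IsIntegral A (algebraMap A K (b * t) * h) := by
        rwa [map_mul, mul_assoc, ← hI]
      have hle : I t ≤ I (b * t) := fun s hs => by
        rw [hI] at hs ⊢
        rw [map_mul, show algebraMap A K s * (algebraMap A K b * algebraMap A K t * h) =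
          algebraMap A K b * (algebraMap A K s * (algebraMap A K t * h)) by ring]
        exact isIntegral_algebraMap.mul hs
      have heq : I t = I (b * t) :=
        hle.eq_of_not_lt (hmax _ ⟨b * t, hb', rfl⟩)
      rw [heq, hI]
      rw [hI] at hab
      convert hab using 1
      simp only [map_mul]
      ring
  set p := I t with hpdef
  let R := Localization.subalgebra.ofField K p.primeCompl p.primeCompl_le_nonZeroDivisors
  have : IsLocalRing R := IsLocalization.AtPrime.isLocalRing R p
  have : IsNoetherianRing R := IsLocalization.isNoetherianRing p.primeCompl R inferInstance
  set h₁ := algebraMap A K t * h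
  have hh₁ : ¬ IsIntegral R h₁ := fun hi => by
    obtain ⟨m, hm⟩ := hi.exists_multiple_integral_of_isLocalization p.primeCompl
    refine m.2 ((hI _ _).mpr ?_)
    rwa [Submonoid.smul_def, Algebra.smul_def] at hm
  have hinv : ∀ s : A, s ∉ p → ∃ r : R, algebraMap A K s * algebraMap R K r = 1 := fun s hs => by
    obtain ⟨r, hr⟩ := (IsLocalization.map_units R (⟨s, hs⟩ : p.primeCompl)).exists_right_inv
    exact ⟨r, congrArg Subtype.val hr⟩
  have hm : ∀ x ∈ IsLocalRing.maximalIdeal R, IsIntegral R (algebraMap R K x * h₁) := by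
    intro x hx
    obtain ⟨⟨a, s⟩, has⟩ := IsLocalization.surj p.primeCompl x
    have hap : a ∈ p := by
      rw [← IsLocalization.AtPrime.to_map_mem_maximal_iff R p, ← has]
      exact Ideal.mul_mem_right _ _ hx
    obtain ⟨r, hr⟩ := hinv s s.2
    have hax : algebraMap R K x * algebraMap A K s = algebraMap A K a := congrArg Subtype.val has
    have : algebraMap R K x * h₁ = algebraMap R K r * (algebraMap A K a * h₁) := by
      rw [← hax]
      linear_combination (- algebraMap R K x * h₁) * hr
    rw [this]
    exact isIntegral_algebraMap.mul (((hI _ _).mp hap).tower_top)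
  obtain ⟨W, hW, hhW, hfrac, L, hL, hexp⟩ := IsLocalRing.exists_valuationSubring_notMem hh₁ hm
  have hAW : ∀ a : A, algebraMap A K a ∈ W := fun a => hW (algebraMap A R a)
  have hunit : ∀ s : A, s ∉ p → W.valuation (algebraMap A K s) = 1 := fun s hs => by
    obtain ⟨r, hr⟩ := hinv s hs
    refine le_antisymm ((W.valuation_le_one_iff _).mpr (hAW s)) ?_
    rw [← map_one W.valuation, ← hr, map_mul]
    exact mul_le_of_le_one_right' ((W.valuation_le_one_iff _).mpr (hW r))
  refine ⟨W, hAW, fun hh => hhW (mul_mem (hAW t) hh), fun u hu => ?_, ?_⟩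
  · obtain ⟨a, s, ha, hs, hs1, e⟩ := hfrac u hu
    obtain ⟨m, hm⟩ := ha.exists_multiple_integral_of_isLocalization p.primeCompl
    obtain ⟨n, hn⟩ := hs.exists_multiple_integral_of_isLocalization p.primeCompl
    rw [Submonoid.smul_def, Algebra.smul_def] at hm hn
    refine ⟨algebraMap A K n * (algebraMap A K m * a), algebraMap A K m * (algebraMap A K n * s),
      isIntegral_algebraMap.mul hm, isIntegral_algebraMap.mul hn, ?_, ?_⟩
    · rw [map_mul, map_mul, hunit _ m.2, hunit _ n.2, hs1, one_mul, one_mul]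
    · rw [← e]; ring
  · have h0 : h₁ ≠ 0 := fun e => hh₁ (e ▸ isIntegral_zero)
    refine W.exists_uniformizer ?_ (inv_ne_zero h0) hL hexp
    rw [map_inv₀]
    exact inv_lt_one_of_one_lt₀ (not_le.mp fun h' => hhW ((W.valuation_le_one_iff h₁).mp h'))

theorem iterate_commutator_pow {E : Type*} [Ring E] {μ ν D : E} (h : D * μ - μ * D = ν)
    (hν : Commute ν μ) (n : ℕ) :
    (fun X => X * μ - μ * X)^[n] (D ^ n) = n.factorial • ν ^ n := by
  set δ : E → E := fun X => X * μ - μ * X with hδ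
  have hmul : ∀ j X, δ^[j + 1] (D * X) = D * δ^[j + 1] X + (j + 1 : ℕ) • (ν * δ^[j] X) := by
    intro j X
    induction j with
    | zero =>
      simp only [zero_add, Function.iterate_one, Function.iterate_zero, id, one_smul, hδ, ← h]
      noncomm_ring
    | succ j ih =>
      rw [Function.iterate_succ_apply', ih, Function.iterate_succ_apply' δ (j + 1),
        Function.iterate_succ_apply' δ j]
      set Y := δ^[j] X
      have e1 : ∀ Z, δ (D * Z) = D * δ Z + ν * Z := fun Z => by
        simp only [hδ, ← h]; noncomm_ring
      have e2 : ∀ Z, δ (ν * Z) = ν * δ Z := fun Z => by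
        simp only [hδ, mul_sub, ← mul_assoc, hν.eq]
      have e3 : ∀ Z T, δ (Z + T) = δ Z + δ T := fun Z T => by simp only [hδ]; noncomm_ring
      have e4 : ∀ (m : ℕ) Z, δ (m • Z) = m • δ Z := fun m Z => by
        simp only [hδ, smul_sub, smul_mul_assoc, mul_smul_comm]
      rw [e3, e1, e4, e2, succ_nsmul _ (j + 1)]
      abel
  have hzero : ∀ n, δ^[n] (D ^ n) = n.factorial • ν ^ n ∧ δ^[n + 1] (D ^ n) = 0 := by
    intro n
    induction n with
    | zero => simp [hδ]
    | succ n ih =>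
      have h0 : ∀ j, δ^[j] (0 : E) = 0 := fun j => Function.iterate_fixed (by simp [hδ]) j
      refine ⟨?_, ?_⟩
      · rw [pow_succ', hmul, ih.2, ih.1, mul_zero, zero_add, mul_smul_comm, smul_smul, pow_succ' ν,
          Nat.factorial_succ]
      · rw [pow_succ', hmul, Function.iterate_succ_apply', ih.2]
        simp [hδ]
  exact (hzero n).1

/-- Seidenberg's theorem: a derivation preserving a Noetherian domain in which the positive integers
are invertible preserves its integral closure. -/
theorem Derivation.isIntegral_apply {A K : Type*} [CommRing A] [IsDomain A] [IsNoetherianRing A]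
    [Field K] [Algebra A K] [IsFractionRing A K] (hA : ∀ n : ℕ, n ≠ 0 → ∃ c : A, c * n = 1)
    (D : Derivation ℤ K K) (hD : ∀ a : A, D (algebraMap A K a) ∈ (algebraMap A K).range)
    {f : K} (hf : IsIntegral A f) : IsIntegral A (D f) := by
  obtain ⟨r, hr, hrf⟩ := hf.isAlmostIntegral
  set M := (algebraMap A K).range
  set c := algebraMap A K r with hc
  have hcf : ∀ n, c * f ^ n ∈ M := fun n => by
    have := hrf n
    rwa [Algebra.smul_def] at this
  let μ : Module.End ℤ K := LinearMap.mulLeft ℤ f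
  let ν : Module.End ℤ K := LinearMap.mulLeft ℤ (D f)
  let E : Module.End ℤ K := D.toLinearMap
  have hE : E * μ - μ * E = ν := by
    ext w
    change D (f * w) - f * D w = D f * w
    rw [D.leibniz]
    simp only [smul_eq_mul]
    ring
  have hνμ : Commute ν μ := by
    ext w
    change D f * (f * w) = f * (D f * w)
    ring
  let P : Module.End ℤ K → Prop := fun X => ∀ i l, c * f ^ i * X (c * f ^ l) ∈ M
  have hP : ∀ X, P X → P (X * μ - μ * X) := fun X hX i l => by
    have : c * f ^ i * (X * μ - μ * X) (c * f ^ l) =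
        c * f ^ i * X (c * f ^ (l + 1)) - c * f ^ (i + 1) * X (c * f ^ l) := by
      change c * f ^ i * (X (f * (c * f ^ l)) - f * X (c * f ^ l)) = _
      rw [show f * (c * f ^ l) = c * f ^ (l + 1) by ring]
      ring
    rw [this]
    exact sub_mem (hX _ _) (hX _ _)
  have hEM : ∀ n, ∀ m ∈ M, (E ^ n) m ∈ M := fun n => by
    induction n with
    | zero => exact fun m hm => hm
    | succ n ih =>
      intro m hm
      rw [pow_succ']
      obtain ⟨a, ha⟩ := ih m hm
      change D ((E ^ n) m) ∈ M
      rw [← ha]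
      exact hD a
  refine IsAlmostIntegral.isIntegral ⟨r * r, mul_mem hr hr, fun n => ?_⟩
  have h1 : P (E ^ n) := fun i l => mul_mem (hcf i) (hEM n _ (hcf l))
  have h2 : ∀ j, P ((fun X => X * μ - μ * X)^[j] (E ^ n)) := fun j => by
    induction j with
    | zero => exact h1
    | succ j ih =>
      rw [Function.iterate_succ_apply']
      exact hP _ ih
  have h3 := h2 n 0 0
  have hνpow : ∀ w, (ν ^ n) w = D f ^ n * w := fun w => by
    rw [LinearMap.pow_mulLeft]
    rfl
  rw [iterate_commutator_pow hE hνμ, LinearMap.smul_apply, hνpow] at h3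
  obtain ⟨d, hd⟩ := hA n.factorial n.factorial_ne_zero
  have hd' : algebraMap A K d * (n.factorial : K) = 1 := by
    rw [← _root_.map_natCast (algebraMap A K), ← map_mul, hd, map_one]
  have : (r * r) • D f ^ n =
      algebraMap A K d * (c * f ^ 0 * n.factorial • (D f ^ n * (c * f ^ 0))) := by
    rw [Algebra.smul_def, map_mul, ← hc, nsmul_eq_mul]
    linear_combination (- c * c * D f ^ n) * hd'
  rw [this]
  exact mul_mem ⟨d, rfl⟩ h3

open Polynomial in
/-- A derivation with bounded denominators on a discrete valuation ring, that is a localization of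
the integral closure of `A`, preserves it as soon as it is regular on `A` and at a uniformizer. -/
theorem Derivation.map_mem_valuationSubring {A K : Type*} [CommRing A] [Field K] [Algebra A K]
    (hA : ∀ n : ℕ, n ≠ 0 → ∃ c : A, c * n = 1) (D : Derivation ℤ K K) (W : ValuationSubring K)
    (hW : ∀ a : A, algebraMap A K a ∈ W)
    (hfrac : ∀ u ∈ W, ∃ a s : K, IsIntegral A a ∧ IsIntegral A s ∧ W.valuation s = 1 ∧ u * s = a)
    {π : K} (hπ0 : π ≠ 0) (hπ : W.valuation π < 1)
    (hmax : ∀ a, W.valuation a < 1 → W.valuation a ≤ W.valuation π)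
    (hDA : ∀ a : A, D (algebraMap A K a) ∈ W) (hDπ : D π ∈ W) {N : ℕ}
    (hN : ∀ w ∈ W, π ^ N * D w ∈ W) : ∀ w ∈ W, D w ∈ W := by
  have hinv : ∀ s z : K, W.valuation s = 1 → s * z ∈ W → z ∈ W := fun s z hs hz => by
    rw [← W.valuation_le_one_iff] at hz ⊢
    rwa [map_mul, hs, one_mul] at hz
  have hπW : π ∈ W := (W.valuation_le_one_iff π).mp hπ.le
  have haeval : ∀ x ∈ W, ∀ P : A[X], aeval x P ∈ W := fun x hx P => by
    induction P using Polynomial.induction_on' with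
    | add p q hp hq => rw [map_add]; exact add_mem hp hq
    | monomial n a => rw [aeval_monomial]; exact mul_mem (hW a) (pow_mem hx n)
  have hchain : ∀ x ∈ W, ∀ P : A[X], D (aeval x P) - aeval x (derivative P) * D x ∈ W := by
    intro x hx P
    induction P using Polynomial.induction_on' with
    | add p q hp hq =>
      simp only [map_add]
      convert add_mem hp hq using 1
      ring
    | monomial n a =>
      rw [derivative_monomial, aeval_monomial, aeval_monomial, D.leibniz, D.leibniz_pow]
      convert mul_mem (pow_mem hx n) (hDA a) using 1
      simp only [smul_eq_mul, nsmul_eq_mul, map_mul, _root_.map_natCast]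
      ring
  induction N with
  | zero => simpa using hN
  | succ N ih =>
    refine ih fun w hw => ?_
    have key : ∀ x, IsIntegral A x → π ^ N * D x ∈ W := by
      intro x hx
      have hxW := W.mem_of_isIntegral hW hx
      have hex : ∃ n : ℕ, ∃ P : A[X], P.Monic ∧ P.natDegree = n ∧ W.valuation (aeval x P) < 1 := by
        obtain ⟨P, hP, h0⟩ := hx
        refine ⟨_, P, hP, rfl, ?_⟩
        rw [aeval_def, h0, map_zero]
        exact zero_lt_one
      classical
      obtain ⟨P, hP, hn, hPx⟩ := Nat.find_spec hex
      have hmin := fun m => Nat.find_min (m := m) hex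
      set n := Nat.find hex
      have hn0 : n ≠ 0 := fun h0 => by
        rw [hP.natDegree_eq_zero.mp (hn.trans h0), map_one, map_one] at hPx
        exact lt_irrefl _ hPx
      have hP' : W.valuation (aeval x (derivative P)) = 1 := by
        refine le_antisymm ((W.valuation_le_one_iff _).mpr (haeval x hxW _))
          (not_lt.mp fun hlt => ?_)
        obtain ⟨c, hc⟩ := hA n hn0
        have hdeg : (C c * derivative P).natDegree ≤ n - 1 :=
          (natDegree_C_mul_le _ _).trans (hn ▸ natDegree_derivative_le P)
        refine hmin _ (lt_of_le_of_lt hdeg (by lia)) ⟨C c * derivative P, ?_, rfl, ?_⟩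
        · refine monic_of_natDegree_le_of_coeff_eq_one (n - 1) hdeg ?_
          have h1 : n - 1 + 1 = n := by lia
          have h2 : ((n - 1 : ℕ) : A) + 1 = n := by exact_mod_cast congrArg Nat.cast h1
          have h3 : P.coeff n = 1 := hn ▸ hP.coeff_natDegree
          rw [coeff_C_mul, coeff_derivative, h2, h1, h3, one_mul, hc]
        · rw [map_mul, aeval_C, map_mul]
          exact (mul_le_of_le_one_left' ((W.valuation_le_one_iff _).mpr (hW c))).trans_lt hlt
      obtain ⟨u, hu, hPu⟩ : ∃ u ∈ W, aeval x P = π * u := by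
        refine ⟨aeval x P / π, ?_, by field_simp⟩
        rw [← W.valuation_le_one_iff, map_div₀,
          div_le_one₀ (zero_lt_iff.mpr (by simpa using hπ0))]
        exact hmax _ hPx
      refine hinv _ _ hP' ?_
      have h1 : π ^ N * D (aeval x P) ∈ W := by
        rw [hPu, D.leibniz]
        convert add_mem (hN u hu) (mul_mem (pow_mem hπW N) (mul_mem hu hDπ)) using 1
        simp only [smul_eq_mul]
        ring
      convert sub_mem h1 (mul_mem (pow_mem hπW N) (hchain x hxW P)) using 1
      ring
    obtain ⟨x, s, hx, hs, hs1, e⟩ := hfrac w hw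
    refine hinv s _ hs1 ?_
    have hD : D x = w * D s + s * D w := by rw [← e, D.leibniz]; rfl
    convert sub_mem (key x hx) (mul_mem hw (key s hs)) using 1
    rw [hD]
    ring

/-- A skew-symmetric biderivation of the fraction field of a Noetherian domain, in which the
positive integers are invertible, preserves the integral closure when it preserves the domain. -/
theorem Derivation.isIntegral_apply_apply_of_skew {A K : Type*} [CommRing A] [IsDomain A]
    [IsNoetherianRing A] [Field K] [Algebra A K] [IsFractionRing A K]
    (hA : ∀ n : ℕ, n ≠ 0 → ∃ c : A, c * n = 1) (D : K → Derivation ℤ K K)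
    (hskew : ∀ x y, D x y = - D y x)
    (hD : ∀ a b : A, D (algebraMap A K a) (algebraMap A K b) ∈ (algebraMap A K).range)
    {f g : K} (hf : IsIntegral A f) (hg : IsIntegral A g) : IsIntegral A (D f g) := by
  by_contra hfg
  obtain ⟨W, hW, hWfg, hfrac, π, hπ0, hπ, hmax, hbdd⟩ :=
    exists_valuationSubring_uniformizer_of_not_isIntegral hfg
  have hle : ∀ z ∈ W, W.valuation z ≤ 1 := fun z hz => (W.valuation_le_one_iff z).mpr hz
  have hDW : ∀ a : A, ∀ w ∈ W, D (algebraMap A K a) w ∈ W := by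
    intro a w hw
    have key : ∀ x, IsIntegral A x → D (algebraMap A K a) x ∈ W := fun x hx =>
      W.mem_of_isIntegral hW ((D (algebraMap A K a)).isIntegral_apply hA (hD a) hx)
    obtain ⟨x, s, hx, hs, hs1, e⟩ := hfrac w hw
    have h1 : s * D (algebraMap A K a) w = D (algebraMap A K a) x - w * D (algebraMap A K a) s := by
      rw [← e, Derivation.leibniz]
      simp only [smul_eq_mul]
      ring
    have h2 := hle _ (sub_mem (key x hx) (mul_mem hw (key s hs)))
    rwa [← h1, map_mul, hs1, one_mul, W.valuation_le_one_iff] at h2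
  have hDbdd : ∀ w : K, ∃ N : ℕ, ∀ u ∈ W, π ^ N * D w u ∈ W := by
    intro w
    obtain ⟨x, s, hs, e⟩ := IsFractionRing.div_surjective (A := A) w
    set S := algebraMap A K s
    have hs0 : S ≠ 0 := IsFractionRing.to_map_ne_zero_of_mem_nonZeroDivisors hs
    obtain ⟨N₁, hN₁⟩ := hbdd S hs0
    obtain ⟨N₂, hN₂W, hN₂⟩ : ∃ N₂ : ℕ, π ^ N₂ ∈ W ∧ π ^ N₂ * w ∈ W := by
      have hπW : π ∈ W := (W.valuation_le_one_iff π).mp hπ.le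
      obtain rfl | hw0 := eq_or_ne w 0
      · exact ⟨0, pow_mem hπW 0, by rw [mul_zero]; exact zero_mem W⟩
      · obtain ⟨N₂, h⟩ := hbdd w⁻¹ (inv_ne_zero hw0)
        refine ⟨N₂, pow_mem hπW _, ?_⟩
        rw [← W.valuation_le_one_iff, map_mul]
        refine (mul_le_mul' h le_rfl).trans ?_
        rw [← map_mul, inv_mul_cancel₀ hw0, map_one]
    have hN₁W : π ^ N₁ / S ∈ W := by
      rw [← W.valuation_le_one_iff, map_div₀, div_le_one₀ (zero_lt_iff.mpr (by simpa using hs0))]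
      exact hN₁
    refine ⟨N₁ + N₂, fun u hu => ?_⟩
    have h1 : S * D w u = D (algebraMap A K x) u - w * D S u := by
      have hx : algebraMap A K x = w * S := by rw [← e]; field_simp
      rw [hskew w, hskew _ u, hskew S, hx, Derivation.leibniz]
      simp only [smul_eq_mul]
      ring
    convert mul_mem hN₁W (sub_mem (mul_mem hN₂W (hDW x u hu)) (mul_mem hN₂ (hDW s u hu))) using 1
    have h2 : D w u = (D (algebraMap A K x) u - w * D S u) / S := by rw [← h1]; field_simp
    rw [h2]
    ring
  have hππ : D π π = 0 := by
    obtain ⟨c, hc⟩ := hA 2 two_ne_zero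
    have hc' : algebraMap A K c * 2 = 1 := by
      rw [← map_ofNat (algebraMap A K) 2, ← map_mul]
      exact (congrArg _ hc).trans (map_one _)
    linear_combination (- D π π) * hc' + algebraMap A K c * hskew π π
  have hswap : ∀ x y, D x y ∈ W → D y x ∈ W := fun x y h => by
    rw [hskew]
    exact neg_mem h
  have hπW : π ∈ W := (W.valuation_le_one_iff π).mp hπ.le
  have hfW := W.mem_of_isIntegral hW hf
  obtain ⟨N, hN⟩ := hDbdd π
  have hDπ := (D π).map_mem_valuationSubring hA W hW hfrac hπ0 hπ hmax
    (fun a => hswap _ _ (hDW a π hπW)) (hππ ▸ zero_mem W) hN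
  obtain ⟨N, hN⟩ := hDbdd f
  exact hWfg ((D f).map_mem_valuationSubring hA W hW hfrac hπ0 hπ hmax
    (fun a => hswap _ _ (hDW a f hfW)) (hswap _ _ (hDπ f hfW)) hN g (W.mem_of_isIntegral hW hg))

/-- A skew-symmetric biadditive operation on the fraction field of a Noetherian domain that
satisfies the Leibniz rule and preserves the domain also preserves its integral closure. -/
theorem isIntegral_of_skew_of_leibniz {A K : Type*} [CommRing A] [IsDomain A]
    [IsNoetherianRing A] [Field K] [Algebra A K] [IsFractionRing A K]
    (hA : ∀ n : ℕ, n ≠ 0 → ∃ c : A, c * n = 1) (B : K → K → K)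
    (hadd : ∀ a x y, B a (x + y) = B a x + B a y) (hskew : ∀ x y, B x y = - B y x)
    (hleib : ∀ a x y, B a (x * y) = B a x * y + B a y * x)
    (hB : ∀ a b : A, B (algebraMap A K a) (algebraMap A K b) ∈ (algebraMap A K).range)
    {f g : K} (hf : IsIntegral A f) (hg : IsIntegral A g) : IsIntegral A (B f g) := by
  let D : K → Derivation ℤ K K := fun a =>
    Derivation.mk' (AddMonoidHom.mk' (B a) (hadd a)).toIntLinearMap fun x y => by
      change B a (x * y) = x * B a y + y * B a x
      rw [hleib]
      ring
  exact Derivation.isIntegral_apply_apply_of_skew hA D hskew hB hf hg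

/-- For a Noetherian Poisson domain `A₀` over a field `k` of characteristic `0`,
the unique extension of the Poisson bracket to `Frac A₀` restricts to a Poisson
bracket on the integral closure `A` of `A₀`: `{f,g} ∈ A` for all `f, g ∈ A`. -/
theorem poissonBracket_preserves_integralClosure {k A₀ : Type*} [Field k] [CharZero k]
    [CommRing A₀] [IsDomain A₀] [IsNoetherianRing A₀] [Algebra k A₀]
    [Algebra k (FractionRing A₀)] [IsScalarTower k A₀ (FractionRing A₀)]
    (b : A₀ → A₀ → A₀) (hb : IsPoissonBracket k b)
    (B : FractionRing A₀ → FractionRing A₀ → FractionRing A₀)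
    (hB : IsPoissonBracket k B)
    (hBb : ∀ x y : A₀, B (algebraMap A₀ (FractionRing A₀) x) (algebraMap A₀ (FractionRing A₀) y)
        = algebraMap A₀ (FractionRing A₀) (b x y)) :
    ∀ f ∈ integralClosure A₀ (FractionRing A₀),
      ∀ g ∈ integralClosure A₀ (FractionRing A₀),
        B f g ∈ integralClosure A₀ (FractionRing A₀) := by
  intro f hf g hg
  obtain ⟨hlin, -, hskew, hleib, -⟩ := hB
  have hadd : ∀ a x y, B a (x + y) = B a x + B a y := fun a => by
    obtain ⟨h, -⟩ := hlin a
    exact h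
  refine isIntegral_of_skew_of_leibniz (fun n hn => ?_) B hadd hskew hleib
    (fun x y => ⟨b x y, (hBb x y).symm⟩) hf hg
  refine ⟨algebraMap k A₀ (n : k)⁻¹, ?_⟩
  rw [← map_natCast (algebraMap k A₀), ← map_mul, inv_mul_cancel₀ (Nat.cast_ne_zero.mpr hn),
    map_one]
end
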